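/- arXiv:1505.07784 — 2 statements merged into one kernel-verified Lean document; each statement's English description precedes it below -/
import Mathlib

section
/- Let H be an additive subgroup of ℝ and Δ ⊆ ℝⁿ an H-rational polyhedron. The following are equivalent: (i) the recession cone is strongly convex, i.e., rec(Δ) ∩ (−rec(Δ)) = {0}; (ii) the subgroup of ℤⁿ generated by Λ_Δ is all of ℤⁿ (equivalently, the subgroup generated by Aff_Δ is the full group of H-affine functions on ℝⁿ). -/
/-- An `H`-affine function on `ℝⁿ`: integer slope, constant term in `H`. -/
def IsAffine (H : AddSubgroup ℝ) {n : ℕ} (F : (Fin n → ℝ) → ℝ) : Prop :=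
  ∃ (a : Fin n → ℤ) (c : ℝ), c ∈ H ∧ ∀ x, F x = (∑ j, (a j : ℝ) * x j) + c

/-- `Aff_Δ`: the monoid of `H`-affine functions bounded above on `Δ`. -/
def AffOn (H : AddSubgroup ℝ) {n : ℕ} (Δ : Set (Fin n → ℝ)) : Set ((Fin n → ℝ) → ℝ) :=
  {F | IsAffine H F ∧ ∃ M : ℝ, ∀ x ∈ Δ, F x ≤ M}

/-- The pairing of an integer vector with real vectors, additive in the former and linear in the
latter. -/
def slopeForm (n : ℕ) : (Fin n → ℤ) →+ Module.Dual ℝ (Fin n → ℝ) :=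
  AddMonoidHom.mk' (fun v ↦ ∑ j, (v j : ℝ) • LinearMap.proj j) fun v w ↦ by
    simp [add_smul, Finset.sum_add_distrib]

theorem slopeForm_apply {n : ℕ} (v : Fin n → ℤ) (x : Fin n → ℝ) :
    slopeForm n v x = ∑ j, (v j : ℝ) * x j := by
  simp [slopeForm]

theorem slopeForm_single {n : ℕ} (v : Fin n → ℤ) (j : Fin n) :
    slopeForm n v (Pi.single j 1) = v j := by
  simp [slopeForm_apply, Pi.single_apply]

/-- The integer slopes whose linear forms are bounded above on `Δ`. -/
def boundedSlopes {n : ℕ} (Δ : Set (Fin n → ℝ)) : AddSubmonoid (Fin n → ℤ) where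
  carrier := {v | ∃ M : ℝ, ∀ x ∈ Δ, slopeForm n v x ≤ M}
  zero_mem' := ⟨0, by simp⟩
  add_mem' := by
    rintro v w ⟨M, hM⟩ ⟨N, hN⟩
    refine ⟨M + N, fun x hx ↦ ?_⟩
    simpa using add_le_add (hM x hx) (hN x hx)

theorem AddSubmonoid.exists_sub_of_mem_closure {G : Type*} [AddCommGroup G] (S : AddSubmonoid G)
    {g : G} (hg : g ∈ AddSubgroup.closure (S : Set G)) : ∃ p ∈ S, ∃ q ∈ S, g = p - q := by
  induction hg using AddSubgroup.closure_induction with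
  | mem x hx => exact ⟨x, hx, 0, S.zero_mem, by simp⟩
  | zero => exact ⟨0, S.zero_mem, 0, S.zero_mem, by simp⟩
  | add x y _ _ hx hy =>
    obtain ⟨p, hp, q, hq, rfl⟩ := hx
    obtain ⟨r, hr, s, hs, rfl⟩ := hy
    exact ⟨p + r, S.add_mem hp hr, q + s, S.add_mem hq hs, by abel⟩
  | neg x _ hx =>
    obtain ⟨p, hp, q, hq, rfl⟩ := hx
    exact ⟨q, hq, p, hp, by abel⟩

theorem AddSubmonoid.closure_eq_top_iff_forall_exists_sub {G : Type*} [AddCommGroup G]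
    (S : AddSubmonoid G) :
    AddSubgroup.closure (S : Set G) = ⊤ ↔ ∀ g : G, ∃ p ∈ S, ∃ q ∈ S, g = p - q := by
  refine ⟨fun h g ↦ S.exists_sub_of_mem_closure (h ▸ AddSubgroup.mem_top g), fun h ↦ ?_⟩
  refine (AddSubgroup.eq_top_iff' _).2 fun g ↦ ?_
  obtain ⟨p, hp, q, hq, rfl⟩ := h g
  exact sub_mem (AddSubgroup.subset_closure hp) (AddSubgroup.subset_closure hq)

/-- A linear form bounded above on a set containing the line `x₀ + ℝ u` vanishes on `u`. -/
theorem slopeForm_eq_zero_of_line {n : ℕ} {Δ : Set (Fin n → ℝ)} {x₀ u : Fin n → ℝ}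
    (hline : ∀ t : ℝ, x₀ + t • u ∈ Δ) {v : Fin n → ℤ} (hv : v ∈ boundedSlopes Δ) :
    slopeForm n v u = 0 := by
  obtain ⟨M, hM⟩ := hv
  by_contra h
  have := hM _ (hline ((M + 1 - slopeForm n v x₀) / slopeForm n v u))
  rw [map_add, map_smul, smul_eq_mul, div_mul_cancel₀ _ h] at this
  linarith

/-- If the constraint normals have no common real zero but `0`, every integer vector is a
difference of slopes bounded above on the polyhedron. -/
theorem exists_sub_of_trivial_lineality {n m : ℕ} (a : Fin m → Fin n → ℤ) (b : Fin m → ℝ)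
    (h : ∀ u, (∀ i, slopeForm n (a i) u = 0) → u = 0) (v : Fin n → ℤ) :
    ∃ p ∈ boundedSlopes {x | ∀ i, slopeForm n (a i) x ≤ b i},
      ∃ q ∈ boundedSlopes {x | ∀ i, slopeForm n (a i) x ≤ b i}, v = p - q := by
  set Δ := {x | ∀ i, slopeForm n (a i) x ≤ b i}
  have hspan : slopeForm n v ∈ Submodule.span ℝ (Set.range fun i ↦ slopeForm n (a i)) := by
    refine mem_span_of_iInf_ker_le_ker fun u hu ↦ ?_
    simp only [Submodule.mem_iInf, LinearMap.mem_ker] at hu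
    simp [h u hu]
  obtain ⟨c, hc⟩ := (Submodule.mem_span_range_iff_exists_fun ℝ).1 hspan
  obtain ⟨K, hK⟩ := exists_nat_ge (∑ i, |c i|)
  have hcK (i : Fin m) : 0 ≤ c i + K := by
    have := Finset.single_le_sum (fun i _ ↦ abs_nonneg (c i)) (Finset.mem_univ i)
    linarith [neg_abs_le (c i)]
  have ha (i : Fin m) : a i ∈ boundedSlopes Δ := ⟨b i, fun x hx ↦ hx i⟩
  refine ⟨v + K • ∑ i, a i, ⟨∑ i, (c i + K) * b i, fun x hx ↦ ?_⟩, K • ∑ i, a i,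
    nsmul_mem (sum_mem fun i _ ↦ ha i) K, by abel⟩
  have hx' : slopeForm n (v + K • ∑ i, a i) x = ∑ i, (c i + K) * slopeForm n (a i) x := by
    rw [map_add, ← hc, map_nsmul, map_sum]
    simp [add_mul, Finset.sum_add_distrib, Finset.mul_sum]
  rw [hx']
  exact Finset.sum_le_sum fun i _ ↦ mul_le_mul_of_nonneg_left (hx i) (hcK i)

/-- The lineality space of a nonempty polyhedron is trivial iff the slopes bounded above on the
polyhedron generate the integer lattice. -/
theorem trivial_lineality_iff {n m : ℕ} (a : Fin m → Fin n → ℤ) (b : Fin m → ℝ)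
    (hne : {x | ∀ i, slopeForm n (a i) x ≤ b i}.Nonempty) :
    (∀ u, (∀ i, slopeForm n (a i) u = 0) → u = 0) ↔
      AddSubgroup.closure
        (boundedSlopes {x | ∀ i, slopeForm n (a i) x ≤ b i} : Set (Fin n → ℤ)) = ⊤ := by
  rw [AddSubmonoid.closure_eq_top_iff_forall_exists_sub]
  refine ⟨exists_sub_of_trivial_lineality a b, fun h u hu ↦ ?_⟩
  obtain ⟨x₀, hx₀⟩ := hne
  have hline (t : ℝ) : x₀ + t • u ∈ {x | ∀ i, slopeForm n (a i) x ≤ b i} := fun i ↦ by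
    simpa [hu i] using hx₀ i
  ext j
  obtain ⟨p, hp, q, hq, hpq⟩ := h (Pi.single j 1)
  have : slopeForm n (Pi.single j 1) u = 0 := by
    rw [hpq, map_sub, LinearMap.sub_apply, slopeForm_eq_zero_of_line hline hp,
      slopeForm_eq_zero_of_line hline hq, sub_zero]
  simpa [slopeForm_apply, Pi.single_apply] using this

theorem isAffine_iff (H : AddSubgroup ℝ) {n : ℕ} (F : (Fin n → ℝ) → ℝ) :
    IsAffine H F ↔ ∃ v : Fin n → ℤ, ∃ c ∈ H, ∀ x, F x = slopeForm n v x + c := by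
  simp [IsAffine, slopeForm_apply]

theorem mem_affOn_iff (H : AddSubgroup ℝ) {n : ℕ} (Δ : Set (Fin n → ℝ)) (F : (Fin n → ℝ) → ℝ) :
    F ∈ AffOn H Δ ↔ ∃ v ∈ boundedSlopes Δ, ∃ c ∈ H, ∀ x, F x = slopeForm n v x + c := by
  simp only [AffOn, Set.mem_ofPred_eq, isAffine_iff]
  constructor
  · rintro ⟨⟨v, c, hc, hF⟩, M, hM⟩
    exact ⟨v, ⟨M - c, fun x hx ↦ by linarith [hM x hx, hF x]⟩, c, hc, hF⟩
  · rintro ⟨v, ⟨M, hM⟩, c, hc, hF⟩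
    exact ⟨⟨v, c, hc, hF⟩, M + c, fun x hx ↦ by linarith [hM x hx, hF x]⟩

/-- An affine function determines its slope. -/
theorem slope_unique {n : ℕ} {v w : Fin n → ℤ} {c d : ℝ}
    (h : ∀ x, slopeForm n v x + c = slopeForm n w x + d) : v = w := by
  have h0 := h 0
  ext j
  have hj := h (Pi.single j 1)
  simp only [slopeForm_single, map_zero, zero_add] at h0 hj
  exact_mod_cast (by linarith : (v j : ℝ) = w j)

/-- The slopes bounded above on `Δ` generate the integer lattice iff every `H`-affine function is
a difference of `H`-affine functions bounded above on `Δ`. -/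
theorem closure_boundedSlopes_eq_top_iff (H : AddSubgroup ℝ) {n : ℕ} (Δ : Set (Fin n → ℝ)) :
    AddSubgroup.closure (boundedSlopes Δ : Set (Fin n → ℤ)) = ⊤ ↔
      ∀ F : (Fin n → ℝ) → ℝ, IsAffine H F →
        ∃ F₁ ∈ AffOn H Δ, ∃ F₂ ∈ AffOn H Δ, F = F₁ - F₂ := by
  rw [AddSubmonoid.closure_eq_top_iff_forall_exists_sub]
  constructor
  · intro h F hF
    obtain ⟨v, c, hc, hF⟩ := (isAffine_iff H F).1 hF
    obtain ⟨p, hp, q, hq, rfl⟩ := h v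
    refine ⟨fun x ↦ slopeForm n p x + c, (mem_affOn_iff H Δ _).2 ⟨p, hp, c, hc, fun _ ↦ rfl⟩,
      fun x ↦ slopeForm n q x + 0, (mem_affOn_iff H Δ _).2 ⟨q, hq, 0, H.zero_mem, fun _ ↦ rfl⟩, ?_⟩
    ext x
    rw [hF, map_sub, LinearMap.sub_apply, Pi.sub_apply]
    ring
  · intro h v
    obtain ⟨F₁, h₁, F₂, h₂, hF⟩ :=
      h (slopeForm n v) ((isAffine_iff H _).2 ⟨v, 0, H.zero_mem, fun x ↦ (add_zero _).symm⟩)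
    obtain ⟨p, hp, c, -, hF₁⟩ := (mem_affOn_iff H Δ _).1 h₁
    obtain ⟨q, hq, d, -, hF₂⟩ := (mem_affOn_iff H Δ _).1 h₂
    refine ⟨p, hp, q, hq, slope_unique (c := 0) (d := c - d) fun x ↦ ?_⟩
    have := congrFun hF x
    rw [Pi.sub_apply, hF₁, hF₂] at this
    rw [this, map_sub, LinearMap.sub_apply]
    ring


/-- for an `H`-rational polyhedron `Δ`, the recession cone is strongly convex
iff the subgroup of `ℤⁿ` generated by `Λ_Δ` is all of `ℤⁿ`, equivalently the subgroup
generated by `Aff_Δ` is the full group of `H`-affine functions. -/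
theorem stmt_8 (H : AddSubgroup ℝ) (n m : ℕ) (a : Fin m → Fin n → ℤ)
    (b : Fin m → ℝ) (hb : ∀ i, b i ∈ H)
    (Δ : Set (Fin n → ℝ))
    (hΔ : Δ = {x | ∀ i, (∑ j, (a i j : ℝ) * x j) ≤ b i})
    (hne : Δ.Nonempty)
    (rec : Set (Fin n → ℝ))
    (hrec : rec = {u | ∀ i, (∑ j, (a i j : ℝ) * u j) ≤ 0}) :
    (({u : Fin n → ℝ | u ∈ rec ∧ -u ∈ rec} = {0}) ↔
      AddSubgroup.closure
        {v : Fin n → ℤ | ∃ M : ℝ, ∀ x ∈ Δ, (∑ j, (v j : ℝ) * x j) ≤ M} = ⊤) ∧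
    ((AddSubgroup.closure
        {v : Fin n → ℤ | ∃ M : ℝ, ∀ x ∈ Δ, (∑ j, (v j : ℝ) * x j) ≤ M} = ⊤) ↔
      ∀ F : (Fin n → ℝ) → ℝ, IsAffine H F →
        ∃ F₁ ∈ AffOn H Δ, ∃ F₂ ∈ AffOn H Δ, F = F₁ - F₂) := by
  have hΔ' : Δ = {x | ∀ i, slopeForm n (a i) x ≤ b i} := by simp only [hΔ, slopeForm_apply]
  have hΛ : {v : Fin n → ℤ | ∃ M : ℝ, ∀ x ∈ Δ, (∑ j, (v j : ℝ) * x j) ≤ M} =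
      boundedSlopes Δ := by
    simp only [boundedSlopes, slopeForm_apply, AddSubmonoid.coe_set_mk, AddSubsemigroup.coe_set_mk]
  have hlin (u : Fin n → ℝ) : u ∈ rec ∧ -u ∈ rec ↔ ∀ i, slopeForm n (a i) u = 0 := by
    simp only [hrec, Set.mem_ofPred_eq, ← slopeForm_apply, map_neg, neg_nonpos, ← forall_and,
      ← le_antisymm_iff]
  rw [hΛ]
  refine ⟨?_, closure_boundedSlopes_eq_top_iff H Δ⟩
  subst hΔ'
  rw [← trivial_lineality_iff a b hne]
  simp only [hlin, Set.eq_singleton_iff_unique_mem, Set.mem_ofPred_eq, map_zero, implies_true,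
    true_and]
end

section
/- Let H be a nontrivial additive subgroup of ℝ and Δ ⊆ ℝⁿ an H-rational polyhedron. Consider the set Δ(ℝ_∞) of maps φ : Aff_Δ → ℝ ∪ {−∞} (viewed inside the extended reals EReal, so φ never takes the value +∞) such that φ(0) = 0, φ(F + G) = φ(F) + φ(G) for all F, G ∈ Aff_Δ, φ(c) = c for every constant function c ∈ H, and φ(F) ≤ 0 for every F ∈ Aff⁺_Δ. Topologized as a subspace of the product space EReal^{Aff_Δ} (pointwise convergence, with the order topology on EReal), the space Δ(ℝ_∞) is compact. -/
/-- `Aff⁺_Δ`: the monoid of `H`-affine functions nonpositive on `Δ`. -/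
def AffNonpos (H : AddSubgroup ℝ) {n : ℕ} (Δ : Set (Fin n → ℝ)) : Set ((Fin n → ℝ) → ℝ) :=
  {F | IsAffine H F ∧ ∀ x ∈ Δ, F x ≤ 0}

/-- A nontrivial additive subgroup of `ℝ` is unbounded above. -/
lemma exists_mem_addSubgroup_ge {H : AddSubgroup ℝ} (hH : H ≠ ⊥) (M : ℝ) :
    ∃ c ∈ H, M ≤ c := by
  obtain ⟨h, hh, h0⟩ := H.bot_or_exists_ne_zero.resolve_left hH
  have habs : |h| ∈ H := by
    rcases abs_choice h with e | e <;> rw [e]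
    exacts [hh, H.neg_mem hh]
  obtain ⟨k, hk⟩ := Archimedean.arch M (abs_pos.mpr h0)
  exact ⟨k • |h|, H.nsmul_mem habs k, hk⟩

lemma isAffine_const {H : AddSubgroup ℝ} {n : ℕ} {c : ℝ} (hc : c ∈ H) :
    IsAffine H (fun _ : Fin n → ℝ => c) :=
  ⟨0, c, hc, by simp⟩

lemma IsAffine.sub_const {H : AddSubgroup ℝ} {n : ℕ} {F : (Fin n → ℝ) → ℝ}
    (hF : IsAffine H F) {c : ℝ} (hc : c ∈ H) : IsAffine H (fun x => F x - c) := by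
  obtain ⟨a, d, hd, h⟩ := hF
  exact ⟨a, d - c, H.sub_mem hd hc, fun x => by simp only [h]; ring⟩

/-- A monoid homomorphism on `Aff_Δ` fixing the constants and nonpositive on `Aff⁺_Δ` is bounded
at `F` by every constant in `H` that bounds `F` on `Δ`. -/
lemma apply_le_of_forall_le {H : AddSubgroup ℝ} {n : ℕ} {Δ : Set (Fin n → ℝ)}
    {φ : ↥(AffOn H Δ) → EReal}
    (hadd : ∀ F G S : ↥(AffOn H Δ),
      (F : (Fin n → ℝ) → ℝ) + (G : (Fin n → ℝ) → ℝ) = (S : (Fin n → ℝ) → ℝ) →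
      φ S = φ F + φ G)
    (hconst : ∀ c : ℝ, c ∈ H → ∀ F : ↥(AffOn H Δ),
      (F : (Fin n → ℝ) → ℝ) = (fun _ => c) → φ F = (c : EReal))
    (hnonpos : ∀ F : ↥(AffOn H Δ), (F : (Fin n → ℝ) → ℝ) ∈ AffNonpos H Δ → φ F ≤ 0)
    (F : ↥(AffOn H Δ)) {c : ℝ} (hc : c ∈ H)
    (hFc : ∀ x ∈ Δ, (F : (Fin n → ℝ) → ℝ) x ≤ c) : φ F ≤ c := by
  have hsub := F.2.1.sub_const hc
  have hle : ∀ x ∈ Δ, (F : (Fin n → ℝ) → ℝ) x - c ≤ 0 := fun x hx => sub_nonpos.mpr (hFc x hx)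
  let G : ↥(AffOn H Δ) := ⟨_, hsub, 0, hle⟩
  let C : ↥(AffOn H Δ) := ⟨fun _ => c, isAffine_const hc, c, fun _ _ => le_rfl⟩
  rw [hadd G C F (by ext x; simp [G, C]), hconst c hc C rfl]
  simpa using add_le_add_left (hnonpos G ⟨hsub, hle⟩) (c : EReal)

/-- Addition on `EReal` is continuous once both arguments are truncated at real numbers. -/
lemma continuous_min_coe_add_min_coe {X : Type*} [TopologicalSpace X] {f g : X → EReal}
    (hf : Continuous f) (hg : Continuous g) (c d : ℝ) :
    Continuous fun x => min (f x) (c : EReal) + min (g x) (d : EReal) := by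
  have h (y : EReal) (r : ℝ) : min y (r : EReal) ≠ ⊤ :=
    ((min_le_right _ _).trans_lt (EReal.coe_lt_top r)).ne
  refine continuous_iff_continuousAt.mpr fun x => ?_
  exact (EReal.continuousAt_add (p := (min (f x) (c : EReal), min (g x) (d : EReal)))
    (Or.inl (h _ _)) (Or.inr (h _ _))).comp
    (f := fun x => (min (f x) (c : EReal), min (g x) (d : EReal)))
    (by fun_prop)

/-- the space `Δ(ℝ_∞)` of monoid homomorphisms `Aff_Δ → ℝ ∪ {−∞}`
(never taking the value `+∞`) fixing the constants in `H` and nonpositive on `Aff⁺_Δ`,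
topologized as a subspace of `EReal ^ Aff_Δ`, is compact. -/
theorem stmt_11 (H : AddSubgroup ℝ) (hH : H ≠ ⊥) (n m : ℕ) (a : Fin m → Fin n → ℤ)
    (b : Fin m → ℝ) (hb : ∀ i, b i ∈ H)
    (Δ : Set (Fin n → ℝ))
    (hΔ : Δ = {x | ∀ i, (∑ j, (a i j : ℝ) * x j) ≤ b i})
    (hne : Δ.Nonempty) :
    IsCompact {φ : ↥(AffOn H Δ) → EReal |
      (∀ F, φ F ≠ ⊤) ∧
      (∀ F : ↥(AffOn H Δ), (F : (Fin n → ℝ) → ℝ) = 0 → φ F = 0) ∧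
      (∀ F G S : ↥(AffOn H Δ),
        (F : (Fin n → ℝ) → ℝ) + (G : (Fin n → ℝ) → ℝ) = (S : (Fin n → ℝ) → ℝ) →
        φ S = φ F + φ G) ∧
      (∀ c : ℝ, c ∈ H → ∀ F : ↥(AffOn H Δ),
        (F : (Fin n → ℝ) → ℝ) = (fun _ => c) → φ F = (c : EReal)) ∧
      (∀ F : ↥(AffOn H Δ), (F : (Fin n → ℝ) → ℝ) ∈ AffNonpos H Δ → φ F ≤ 0)} := by
  have hbound (F : ↥(AffOn H Δ)) : ∃ c ∈ H, ∀ x ∈ Δ, (F : (Fin n → ℝ) → ℝ) x ≤ c := by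
    obtain ⟨M, hM⟩ := F.2.2
    obtain ⟨c, hc, hMc⟩ := exists_mem_addSubgroup_ge hH M
    exact ⟨c, hc, fun x hx => (hM x hx).trans hMc⟩
  choose c hc hFc using hbound
  have hclosed : IsClosed {φ : ↥(AffOn H Δ) → EReal |
      (∀ F, φ F ≤ c F) ∧
      (∀ F : ↥(AffOn H Δ), (F : (Fin n → ℝ) → ℝ) = 0 → φ F = 0) ∧
      (∀ F G S : ↥(AffOn H Δ),
        (F : (Fin n → ℝ) → ℝ) + (G : (Fin n → ℝ) → ℝ) = (S : (Fin n → ℝ) → ℝ) →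
        φ S = min (φ F) (c F) + min (φ G) (c G)) ∧
      (∀ r : ℝ, r ∈ H → ∀ F : ↥(AffOn H Δ),
        (F : (Fin n → ℝ) → ℝ) = (fun _ => r) → φ F = (r : EReal)) ∧
      (∀ F : ↥(AffOn H Δ), (F : (Fin n → ℝ) → ℝ) ∈ AffNonpos H Δ → φ F ≤ 0)} := by
    simp only [Set.ofPred_and, Set.ofPred_forall]
    refine .inter ?_ (.inter ?_ (.inter ?_ (.inter ?_ ?_)))
    · exact isClosed_iInter fun F => isClosed_le (continuous_apply F) continuous_const
    · exact isClosed_iInter fun F => isClosed_iInter fun _ =>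
        isClosed_eq (continuous_apply F) continuous_const
    · exact isClosed_iInter fun F => isClosed_iInter fun G => isClosed_iInter fun S =>
        isClosed_iInter fun _ => isClosed_eq (continuous_apply S)
          (continuous_min_coe_add_min_coe (continuous_apply F) (continuous_apply G) (c F) (c G))
    · exact isClosed_iInter fun r => isClosed_iInter fun _ => isClosed_iInter fun F =>
        isClosed_iInter fun _ => isClosed_eq (continuous_apply F) continuous_const
    · exact isClosed_iInter fun F => isClosed_iInter fun _ =>
        isClosed_le (continuous_apply F) continuous_const
  convert hclosed.isCompact using 1
  ext φ
  constructor
  · rintro ⟨-, hzero, hadd, hconst, hnonpos⟩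
    have hle (F) : φ F ≤ c F := apply_le_of_forall_le hadd hconst hnonpos F (hc F) (hFc F)
    refine ⟨hle, hzero, fun F G S h => ?_, hconst, hnonpos⟩
    rw [min_eq_left (hle F), min_eq_left (hle G), hadd F G S h]
  · rintro ⟨hle, hzero, hadd, hconst, hnonpos⟩
    refine ⟨fun F => ((hle F).trans_lt (EReal.coe_lt_top _)).ne, hzero, fun F G S h => ?_,
      hconst, hnonpos⟩
    rw [hadd F G S h, min_eq_left (hle F), min_eq_left (hle G)]
end
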